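/- Let p be an odd prime, n a positive integer, q = p^n with q ≡ 3 (mod 4), and let F be a finite field with exactly q elements. Let Γ₀³ = {(ξ₁,ξ₂,τ,σ) ∈ F⁴ : τσ = ξ₁² + ξ₂²} and Γ³ = Γ₀³ \ {0}. Then for every η ∈ F⁴, the number of pairs (η₁,η₂) ∈ Γ₀³ × Γ₀³ with η₁ + η₂ = η equals: q(q² − q + 1) if η = 0; q if η ∈ Γ³; and q(q − 1) if η ∉ Γ₀³. -/

import Mathlib

open Finset

section PlaneCounts

variable {F : Type} [Field F]

lemma sq_add_sq_eq_zero_of_not_isSquare_neg_one (h : ¬ IsSquare (-1 : F)) {x y : F}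
    (hxy : x ^ 2 + y ^ 2 = 0) : x = 0 ∧ y = 0 := by
  have hy : y = 0 := by
    by_contra hy
    refine h ⟨x / y, ?_⟩
    field_simp
    linear_combination -hxy
  subst hy
  simpa using hxy

lemma sum_card_filter_eq {α β : Type} [Fintype α] [Fintype β] [DecidableEq β] (f : α → β) :
    ∑ k, #{z | f z = k} = Fintype.card α := by
  rw [← Finset.card_univ, Finset.card_eq_sum_card_fiberwise (f := f) (t := univ) (by simp)]

variable [Fintype F] [DecidableEq F]

lemma card_circle_zero (h : ¬ IsSquare (-1 : F)) :
    #{z : F × F | z.1 ^ 2 + z.2 ^ 2 = 0} = 1 := by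
  rw [Finset.card_eq_one]
  refine ⟨(0, 0), ?_⟩
  ext ⟨x, y⟩
  simp only [mem_filter, mem_univ, true_and, mem_singleton, Prod.mk.injEq]
  constructor
  · exact sq_add_sq_eq_zero_of_not_isSquare_neg_one h
  · rintro ⟨rfl, rfl⟩
    simp

lemma card_circle_eq_card_unit_circle (h2 : Fintype.card F % 2 = 1) {k : F} (hk : k ≠ 0) :
    #{z : F × F | z.1 ^ 2 + z.2 ^ 2 = k} = #{z : F × F | z.1 ^ 2 + z.2 ^ 2 = 1} := by
  obtain ⟨e, f, hef⟩ : ∃ e f : F, e ^ 2 + f ^ 2 = k := by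
    obtain ⟨e, f, hef⟩ := FiniteField.exists_root_sum_quadratic
      (f := (Polynomial.X ^ 2 : Polynomial F)) (g := Polynomial.X ^ 2 - Polynomial.C k)
      (by simp) (Polynomial.degree_X_pow_sub_C (by norm_num) k) h2
    refine ⟨e, f, ?_⟩
    simp at hef
    linear_combination hef
  symm
  refine Finset.card_nbij' (fun z => (e * z.1 - f * z.2, f * z.1 + e * z.2))
    (fun z => ((e * z.1 + f * z.2) / k, (e * z.2 - f * z.1) / k)) ?_ ?_ ?_ ?_
  · rintro ⟨x, y⟩ hz
    simp at hz ⊢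
    linear_combination k * hz + (x ^ 2 + y ^ 2) * hef
  · rintro ⟨x, y⟩ hz
    simp at hz ⊢
    field_simp
    linear_combination k * hz + (x ^ 2 + y ^ 2) * hef
  · rintro ⟨x, y⟩ -
    ext
    · simp only
      field_simp
      linear_combination x * hef
    · simp only
      field_simp
      linear_combination y * hef
  · rintro ⟨x, y⟩ -
    ext
    · simp only
      field_simp
      linear_combination x * hef
    · simp only
      field_simp
      linear_combination y * hef

lemma card_circle (h : ¬ IsSquare (-1 : F)) (h2 : Fintype.card F % 2 = 1) {k : F} (hk : k ≠ 0) :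
    #{z : F × F | z.1 ^ 2 + z.2 ^ 2 = k} = Fintype.card F + 1 := by
  rw [card_circle_eq_card_unit_circle h2 hk]
  have hsum := sum_card_filter_eq (fun z : F × F => z.1 ^ 2 + z.2 ^ 2)
  rw [← Finset.add_sum_erase _ _ (mem_univ (0 : F)), card_circle_zero h,
    Finset.sum_congr rfl (fun k hk => card_circle_eq_card_unit_circle h2 (ne_of_mem_erase hk)),
    Finset.sum_const, Finset.card_erase_of_mem (mem_univ _), Finset.card_univ, Fintype.card_prod,
    smul_eq_mul] at hsum
  obtain ⟨r, hr⟩ := Nat.exists_eq_add_of_lt (Fintype.one_lt_card (α := F))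
  rw [hr] at hsum ⊢
  simp only [show 1 + r + 1 - 1 = r + 1 by omega] at hsum
  apply Nat.eq_of_mul_eq_mul_left (Nat.succ_pos r)
  simp only [Nat.succ_eq_add_one]
  linarith

lemma card_hyperbola {k : F} (hk : k ≠ 0) :
    #{z : F × F | z.1 * z.2 = k} = Fintype.card F - 1 := by
  rw [← Finset.card_univ, ← Finset.card_erase_of_mem (mem_univ (0 : F))]
  refine Finset.card_nbij' (fun z => z.1) (fun t => (t, k / t)) ?_ ?_ ?_ ?_
  · rintro ⟨t, s⟩ hz
    simp at hz ⊢
    rintro rfl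
    exact hk (by simpa using hz.symm)
  · intro t ht
    simp at ht ⊢
    field_simp
  · rintro ⟨t, s⟩ hz
    simp at hz ⊢
    have ht : t ≠ 0 := by
      rintro rfl
      exact hk (by simpa using hz.symm)
    field_simp
    exact hz.symm
  · intro t _
    rfl

lemma card_hyperbola_zero :
    #{z : F × F | z.1 * z.2 = 0} + (Fintype.card F - 1) ^ 2 = Fintype.card F ^ 2 := by
  have hsum := sum_card_filter_eq (fun z : F × F => z.1 * z.2)
  rw [← Finset.add_sum_erase _ _ (mem_univ (0 : F)),
    Finset.sum_congr rfl (fun k hk => card_hyperbola (ne_of_mem_erase hk)),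
    Finset.sum_const, Finset.card_erase_of_mem (mem_univ _), Finset.card_univ, Fintype.card_prod,
    smul_eq_mul] at hsum
  rw [sq, sq, hsum]

end PlaneCounts

section Cone

variable {F : Type} [Field F] [Fintype F] [DecidableEq F]

/-- The number of ways of writing `(a, b, c, d)` as a sum of two points of the full cone. -/
def coneRepCount (a b c d : F) : ℕ :=
  #{v : F × F × F × F | v.2.2.1 * v.2.2.2 = v.1 ^ 2 + v.2.1 ^ 2 ∧
    (c - v.2.2.1) * (d - v.2.2.2) = (a - v.1) ^ 2 + (b - v.2.1) ^ 2}

lemma coneRepCount_swap (a b c d : F) : coneRepCount a b c d = coneRepCount a b d c := by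
  refine Finset.card_nbij' (fun v => (v.1, v.2.1, v.2.2.2, v.2.2.1))
    (fun v => (v.1, v.2.1, v.2.2.2, v.2.2.1)) ?_ ?_ ?_ ?_
  · rintro ⟨x, y, t, s⟩ hv
    simp at hv ⊢
    rwa [mul_comm s t, mul_comm (d - s)]
  · rintro ⟨x, y, t, s⟩ hv
    simp at hv ⊢
    rwa [mul_comm s t, mul_comm (c - s)]
  · intro v _
    rfl
  · intro v _
    rfl

lemma coneRepCount_zero (h : ¬ IsSquare (-1 : F)) :
    coneRepCount (0 : F) 0 0 0 = Fintype.card F * (Fintype.card F ^ 2 - Fintype.card F + 1) := by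
  have hfib : coneRepCount (0 : F) 0 0 0 =
      ∑ z : F × F, #{w : F × F | w.1 * w.2 = z.1 ^ 2 + z.2 ^ 2} := by
    rw [← Finset.card_sigma]
    refine Finset.card_nbij' (fun v => ⟨(v.1, v.2.1), (v.2.2.1, v.2.2.2)⟩)
      (fun w => (w.1.1, w.1.2, w.2.1, w.2.2)) ?_ ?_ ?_ ?_
    · rintro ⟨x, y, t, s⟩ hv
      simp at hv ⊢
      exact hv
    · rintro ⟨⟨x, y⟩, t, s⟩ hv
      simp at hv ⊢
      exact hv
    · intro v _
      rfl
    · intro v _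
      rfl
  have hne : ∀ z ∈ univ.erase (0 : F × F),
      #{w : F × F | w.1 * w.2 = z.1 ^ 2 + z.2 ^ 2} = Fintype.card F - 1 := by
    rintro ⟨x, y⟩ hz
    refine card_hyperbola fun h0 => ne_of_mem_erase hz ?_
    obtain ⟨rfl, rfl⟩ := sq_add_sq_eq_zero_of_not_isSquare_neg_one h h0
    rfl
  rw [hfib, ← Finset.add_sum_erase _ _ (mem_univ (0 : F × F)), Finset.sum_congr rfl hne,
    Finset.sum_const, Finset.card_erase_of_mem (mem_univ _), Finset.card_univ, Fintype.card_prod,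
    smul_eq_mul]
  have h0 := card_hyperbola_zero (F := F)
  obtain ⟨r, hr⟩ := Nat.exists_eq_add_of_lt (Fintype.one_lt_card (α := F))
  rw [hr] at h0 ⊢
  have e1 : (1 + r + 1) * (1 + r + 1) - 1 = r ^ 2 + 4 * r + 3 := by
    rw [Nat.sub_eq_iff_eq_add (by nlinarith)]; ring
  have e2 : (1 + r + 1) ^ 2 - (1 + r + 1) = r ^ 2 + 3 * r + 2 := by
    rw [Nat.sub_eq_iff_eq_add (by nlinarith)]; ring
  rw [e1, e2]
  simp only [show 1 + r + 1 - 1 = r + 1 by omega, Prod.fst_zero, Prod.snd_zero] at h0 ⊢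
  norm_num at h0 ⊢
  nlinarith

lemma coneRepCount_eq_sum {a b c d : F} (hd : d ≠ 0) :
    coneRepCount a b c d =
      ∑ s, #{z : F × F | z.1 ^ 2 + z.2 ^ 2 = (c * d - a ^ 2 - b ^ 2) * (s * (d - s))} := by
  rw [← Finset.card_sigma]
  refine Finset.card_nbij'
    (fun v => ⟨v.2.2.2, (d * v.1 - v.2.2.2 * a, d * v.2.1 - v.2.2.2 * b)⟩)
    (fun w => ((w.2.1 + w.1 * a) / d, (w.2.2 + w.1 * b) / d,
      (c * d - a ^ 2 - b ^ 2 - w.1 * c +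
        2 * ((w.2.1 + w.1 * a) / d * a + (w.2.2 + w.1 * b) / d * b)) / d, w.1)) ?_ ?_ ?_ ?_
  · rintro ⟨x, y, t, s⟩ hv
    simp at hv ⊢
    linear_combination (d * s - d ^ 2) * hv.1 - d * s * hv.2
  · rintro ⟨s, X, Y⟩ hv
    simp at hv ⊢
    constructor
    · field_simp
      linear_combination -hv
    · field_simp
      linear_combination -hv
  · rintro ⟨x, y, t, s⟩ hv
    simp at hv ⊢
    refine ⟨by field_simp, by field_simp, ?_⟩
    field_simp
    linear_combination hv.2 - hv.1
  · rintro ⟨s, X, Y⟩ hv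
    simp
    constructor <;> field_simp <;> ring

lemma coneRepCount_of_isotropic (h : ¬ IsSquare (-1 : F)) {a b c d : F} (hd : d ≠ 0)
    (hm : c * d = a ^ 2 + b ^ 2) : coneRepCount a b c d = Fintype.card F := by
  rw [coneRepCount_eq_sum hd, show c * d - a ^ 2 - b ^ 2 = 0 by linear_combination hm]
  simp only [zero_mul, card_circle_zero h]
  simp

lemma coneRepCount_of_anisotropic (h : ¬ IsSquare (-1 : F)) (h2 : Fintype.card F % 2 = 1)
    {a b c d : F} (hd : d ≠ 0) (hm : c * d ≠ a ^ 2 + b ^ 2) :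
    coneRepCount a b c d = Fintype.card F * (Fintype.card F - 1) := by
  have hm' : c * d - a ^ 2 - b ^ 2 ≠ 0 := fun h0 => hm (by linear_combination h0)
  have hd' : d ∈ univ.erase (0 : F) := by simp [hd]
  have hne : ∀ s ∈ (univ.erase (0 : F)).erase d,
      #{z : F × F | z.1 ^ 2 + z.2 ^ 2 = (c * d - a ^ 2 - b ^ 2) * (s * (d - s))} =
        Fintype.card F + 1 := by
    intro s hs
    simp only [mem_erase, mem_univ, and_true] at hs
    exact card_circle h h2 (mul_ne_zero hm' (mul_ne_zero hs.2 (sub_ne_zero.2 hs.1.symm)))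
  rw [coneRepCount_eq_sum hd, ← Finset.add_sum_erase _ _ (mem_univ (0 : F)),
    ← Finset.add_sum_erase _ _ hd', Finset.sum_congr rfl hne, Finset.sum_const,
    Finset.card_erase_of_mem hd', Finset.card_erase_of_mem (mem_univ _), Finset.card_univ]
  simp only [zero_mul, mul_zero, sub_self, card_circle_zero h, smul_eq_mul]
  obtain ⟨r, hr⟩ := Nat.exists_eq_add_of_lt (Fintype.one_lt_card (α := F))
  rw [hr]
  simp only [show 1 + r + 1 - 1 = r + 1 by omega, Nat.add_sub_cancel]
  ring

lemma coneRepCount_of_plane (h : ¬ IsSquare (-1 : F)) (h2 : (2 : F) ≠ 0) {a b : F}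
    (hab : a ^ 2 + b ^ 2 ≠ 0) :
    coneRepCount a b 0 0 = Fintype.card F * (Fintype.card F - 1) := by
  have hfib : coneRepCount a b 0 0 =
      ∑ u : F, #{w : F × F | w.1 * w.2 = (a ^ 2 + b ^ 2) * ((1 / 2) ^ 2 + u ^ 2)} := by
    rw [← Finset.card_sigma]
    refine Finset.card_nbij'
      (fun v => ⟨(b * v.1 - a * v.2.1) / (a ^ 2 + b ^ 2), (v.2.2.1, v.2.2.2)⟩)
      (fun w => (a / 2 + b * w.1, b / 2 - a * w.1, w.2.1, w.2.2)) ?_ ?_ ?_ ?_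
    · rintro ⟨x, y, t, s⟩ hv
      simp at hv ⊢
      obtain ⟨h1, h3⟩ := hv
      have hlin : 2 * (a * x + b * y) = a ^ 2 + b ^ 2 := by linear_combination h3 - h1
      rw [h1]
      field_simp
      linear_combination (-2 * (a * x + b * y) - (a ^ 2 + b ^ 2)) * (-hlin)
    · rintro ⟨u, t, s⟩ hv
      simp at hv ⊢
      constructor
      · rw [hv]
        field_simp
        ring
      · rw [hv]
        field_simp
        ring
    · rintro ⟨x, y, t, s⟩ hv
      simp at hv ⊢
      obtain ⟨h1, h3⟩ := hv
      have hlin : 2 * (a * x + b * y) = a ^ 2 + b ^ 2 := by linear_combination h3 - h1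
      constructor
      · field_simp
        linear_combination -a * hlin
      · field_simp
        linear_combination -b * hlin
    · rintro ⟨u, t, s⟩ _
      simp
      field_simp
      ring
  have hne : ∀ u ∈ (univ : Finset F),
      #{w : F × F | w.1 * w.2 = (a ^ 2 + b ^ 2) * ((1 / 2) ^ 2 + u ^ 2)} =
        Fintype.card F - 1 := by
    intro u _
    refine card_hyperbola (mul_ne_zero hab fun h0 => ?_)
    exact one_div_ne_zero h2 (sq_add_sq_eq_zero_of_not_isSquare_neg_one h h0).1
  rw [hfib, Finset.sum_congr rfl hne, Finset.sum_const, Finset.card_univ, smul_eq_mul]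

lemma card_cone_pairs (a b c d : F) (Γ : Finset (F × F × F × F))
    (hΓ : Γ = univ.filter (fun v => v.2.2.1 * v.2.2.2 = v.1 ^ 2 + v.2.1 ^ 2)) :
    #{y ∈ Γ ×ˢ Γ | y.1 + y.2 = (a, b, c, d)} = coneRepCount a b c d := by
  subst hΓ
  refine Finset.card_nbij' (fun y => y.1) (fun v => (v, (a, b, c, d) - v)) ?_ ?_ ?_ ?_
  · rintro ⟨v, w⟩ hy
    simp only [coe_filter, mem_product, mem_filter, mem_univ, true_and, Set.mem_ofPred_eq] at hy ⊢
    obtain ⟨⟨hv, hw⟩, hvw⟩ := hy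
    rw [← eq_sub_iff_add_eq'] at hvw
    subst hvw
    exact ⟨hv, hw⟩
  · intro v hv
    simp only [coe_filter, mem_product, mem_filter, mem_univ, true_and, Set.mem_ofPred_eq] at hv ⊢
    exact ⟨hv, add_sub_cancel _ _⟩
  · rintro ⟨v, w⟩ hy
    simp only [coe_filter, mem_product, mem_filter, mem_univ, true_and, Set.mem_ofPred_eq] at hy ⊢
    rw [← hy.2, add_sub_cancel_left]
  · intro v _
    rfl

end Cone

/-- Two-fold convolution count on the full cone Γ₀³ ⊂ F⁴ when q ≡ 3 (mod 4). -/
theorem full_cone_two_fold_convolution_count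
    (p n q : ℕ) (hp : p.Prime) (hp2 : p ≠ 2) (hn : 0 < n) (hq : q = p ^ n)
    (hq4 : q % 4 = 3)
    (F : Type) [Field F] [Fintype F] [DecidableEq F] (hF : Fintype.card F = q)
    (η : F × F × F × F) :
    let Γ₀ : Finset (F × F × F × F) :=
      univ.filter (fun v => v.2.2.1 * v.2.2.2 = v.1 ^ 2 + v.2.1 ^ 2)
    let Npairs : ℕ := ((Γ₀ ×ˢ Γ₀).filter (fun y => y.1 + y.2 = η)).card
    (η = 0 → Npairs = q * (q ^ 2 - q + 1))
    ∧ (η ∈ Γ₀ → η ≠ 0 → Npairs = q)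
    ∧ (η ∉ Γ₀ → Npairs = q * (q - 1)) := by
  intro Γ₀ Npairs
  have h : ¬ IsSquare (-1 : F) := by
    rw [FiniteField.isSquare_neg_one_iff, hF]
    exact not_not.2 hq4
  have hodd : Fintype.card F % 2 = 1 := by omega
  have h2 : (2 : F) ≠ 0 :=
    Ring.two_ne_zero fun hc => by
      have := FiniteField.even_card_iff_char_two.1 hc
      omega
  obtain ⟨a, b, c, d⟩ := η
  have hN : Npairs = coneRepCount a b c d := card_cone_pairs a b c d Γ₀ rfl
  have hmem : (a, b, c, d) ∈ Γ₀ ↔ c * d = a ^ 2 + b ^ 2 := by simp [Γ₀]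
  rw [hN, hmem, ← hF]
  refine ⟨fun h0 => ?_, fun hm h0 => ?_, fun hm => ?_⟩
  · simp only [Prod.mk_eq_zero] at h0
    obtain ⟨rfl, rfl, rfl, rfl⟩ := h0
    exact coneRepCount_zero h
  · by_cases hd : d = 0
    · by_cases hc : c = 0
      · subst hc hd
        obtain ⟨rfl, rfl⟩ :=
          sq_add_sq_eq_zero_of_not_isSquare_neg_one h (x := a) (y := b)
            (by linear_combination -hm)
        exact absurd rfl h0
      · rw [coneRepCount_swap]
        exact coneRepCount_of_isotropic h hc (by rw [mul_comm, hm])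
    · exact coneRepCount_of_isotropic h hd hm
  · by_cases hd : d = 0
    · by_cases hc : c = 0
      · subst hc hd
        exact coneRepCount_of_plane h h2 fun h0 => hm (by rw [h0, mul_zero])
      · rw [coneRepCount_swap]
        exact coneRepCount_of_anisotropic h hodd hc (by rwa [mul_comm])
    · exact coneRepCount_of_anisotropic h hodd hd hm
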